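/- arXiv:math/0201311 — 2 statements merged into one kernel-verified Lean document; each statement's English description precedes it below -/
import Mathlib

section
/- The ring homomorphism ℤ[x,y] → K determined by x ↦ √−2 and y ↦ f·w is surjective onto R_f with kernel the ideal generated by x² + 2 and y² − f·x·y − f²(D+1)/2; hence it induces a ring isomorphism ℤ[x,y]/(x² + 2, y² − f·x·y − f²(D+1)/2) ≅ R_f. -/
noncomputable section
open Complex Pointwise

/-- `√−2 = i·√2` -/
def sm2 : ℂ := Complex.I * Real.sqrt 2
/-- `√−D = i·√D` -/
def smD (D : ℕ) : ℂ := Complex.I * Real.sqrt D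
/-- `√(2D)` -/
def s2D (D : ℕ) : ℂ := (Real.sqrt (2 * D) : ℝ)
/-- `w = (√(2D) + √−2)/2` -/
def w (D : ℕ) : ℂ := (s2D D + sm2) / 2
/-- `𝒪 = ℤ[√−2]` -/
def OO : Subring ℂ := Subring.closure {sm2}
/-- `R_f = 𝒪 + f·w·𝒪 = ℤ[√−2, f·w]`, an order in `K`. -/
def Rf (D f : ℕ) : Subring ℂ := Subring.closure {sm2, (f : ℂ) * w D}
/-- `R⁺_f = ℤ[f·√(2D)]`, an order in `K⁺`. -/
def Rpf (D f : ℕ) : Subring ℂ := Subring.closure {(f : ℂ) * s2D D}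
/-- `S_f = ℤ[f·√−D]`, an order in `L`. -/
def Sf (D f : ℕ) : Subring ℂ := Subring.closure {(f : ℂ) * smD D}
/-- `K = ℚ(√−2, √−D)` -/
def Kf (D : ℕ) : IntermediateField ℚ ℂ := IntermediateField.adjoin ℚ {sm2, smD D}
/-- `K⁺ = ℚ(√(2D))`, the maximal real subfield of `K`. -/
def Kp (D : ℕ) : IntermediateField ℚ ℂ := IntermediateField.adjoin ℚ {s2D D}
/-- `L = ℚ(√−D)` -/
def Lf (D : ℕ) : IntermediateField ℚ ℂ := IntermediateField.adjoin ℚ {smD D}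

open MvPolynomial

/-- The ring map `ℤ[x,y] → ℂ` determined by `x ↦ √−2` and `y ↦ f·w`. -/
def evalRf (D f : ℕ) : MvPolynomial (Fin 2) ℤ →+* ℂ :=
  MvPolynomial.eval₂Hom (Int.castRingHom ℂ) ![sm2, (f : ℂ) * w D]

theorem exists_normal_form (k n : ℤ) (p : MvPolynomial (Fin 2) ℤ) :
    ∃ (a b c d : ℤ) (u v : MvPolynomial (Fin 2) ℤ),
      p = C a + C b * X 0 + C c * X 1 + C d * (X 0 * X 1) +
        (u * (X 0 ^ 2 + 2) + v * (X 1 ^ 2 - C k * X 0 * X 1 - C n)) := by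
  induction p using MvPolynomial.induction_on with
  | C a => exact ⟨a, 0, 0, 0, 0, 0, by simp⟩
  | add p q hp hq =>
    obtain ⟨a, b, c, d, u, v, rfl⟩ := hp
    obtain ⟨a', b', c', d', u', v', rfl⟩ := hq
    refine ⟨a + a', b + b', c + c', d + d', u + u', v + v', ?_⟩
    simp only [map_add]
    ring
  | mul_X p i hp =>
    obtain ⟨a, b, c, d, u, v, rfl⟩ := hp
    fin_cases i
    · refine ⟨-2 * b, a, -2 * d, c, u * X 0 + C b + C d * X 1, v * X 0, ?_⟩
      simp only [map_mul, map_neg, map_ofNat, Fin.zero_eta]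
      ring
    · refine ⟨c * n, d * n, a - 2 * (d * k), b + c * k, u * X 1 + C d * C k * X 1,
        v * X 1 + C c + C d * X 0, ?_⟩
      simp only [map_add, map_sub, map_mul, map_ofNat, Fin.mk_one]
      ring

theorem irrational_sqrt_two_mul_of_odd {D : ℕ} (hD : Odd D) : Irrational √(2 * D) := by
  have h : Irrational √((2 * D : ℕ) : ℝ) := by
    rw [irrational_sqrt_natCast_iff]
    rintro ⟨r, hr⟩
    obtain ⟨t, rfl⟩ : Even r := by
      have : Even (r * r) := hr ▸ even_two_mul D
      simpa [Nat.even_mul] using this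
    obtain ⟨j, rfl⟩ := hD
    have : 2 * j + 1 = 2 * (t * t) := by linarith
    omega
  simpa using h

theorem Irrational.eq_zero_of_intCast_add_mul_eq_zero {x : ℝ} (hx : Irrational x) {a b : ℤ}
    (h : (a : ℝ) + b * x = 0) : a = 0 ∧ b = 0 := by
  have hb : b = 0 := by
    by_contra hb
    exact ((hx.intCast_mul hb).intCast_add a).ne_zero h
  subst hb
  exact ⟨by simpa using h, rfl⟩

theorem sm2_sq : sm2 ^ 2 = -2 := by
  have h : ((√2 : ℝ) : ℂ) ^ 2 = 2 := by
    rw [← ofReal_pow, Real.sq_sqrt zero_le_two, ofReal_ofNat]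
  rw [sm2, mul_pow, I_sq, h]
  ring

theorem s2D_sq (D : ℕ) : s2D D ^ 2 = 2 * D := by
  rw [s2D, ← ofReal_pow, Real.sq_sqrt (by positivity)]
  simp

theorem mul_w_sq {D : ℕ} {m : ℤ} (hm : 2 * m = (D : ℤ) + 1) (f : ℂ) :
    (f * w D) ^ 2 = f * sm2 * (f * w D) + f ^ 2 * m := by
  have hm' : 2 * (m : ℂ) = D + 1 := mod_cast hm
  rw [w]
  linear_combination f ^ 2 / 4 * s2D_sq D - f ^ 2 / 4 * sm2_sq - f ^ 2 / 2 * hm'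

theorem coeffs_eq_zero {D f : ℕ} (hD : Odd D) (hf : f ≠ 0) {a b c d : ℤ}
    (h : (a : ℂ) + b * sm2 + c * (f * w D) + d * (sm2 * (f * w D)) = 0) :
    a = 0 ∧ b = 0 ∧ c = 0 ∧ d = 0 := by
  have hirr := irrational_sqrt_two_mul_of_odd hD
  have h2 : (√2 : ℝ) ≠ 0 := by positivity
  have h' : (((2 * (a - d * f) : ℤ) + (c * f : ℤ) * √(2 * D) : ℝ) : ℂ) +
      ((√2 * ((2 * b + c * f : ℤ) + (d * f : ℤ) * √(2 * D)) : ℝ) : ℂ) * I = 0 := by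
    have hs := sm2_sq
    rw [w, s2D] at h
    have hI : sm2 = I * (√2 : ℝ) := rfl
    push_cast
    linear_combination 2 * h - d * f * hs -
      (2 * b + c * f + d * f * ((√(2 * D) : ℝ) : ℂ)) * hI
  have hre := congrArg re h'
  have him := congrArg im h'
  simp only [add_re, re_ofReal_mul, I_re, mul_zero, add_zero, ofReal_re, zero_re] at hre
  simp only [add_im, im_ofReal_mul, I_im, mul_one, zero_add, ofReal_im, zero_im] at him
  obtain ⟨had, hc⟩ := hirr.eq_zero_of_intCast_add_mul_eq_zero hre
  obtain ⟨hbc, hd⟩ :=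
    hirr.eq_zero_of_intCast_add_mul_eq_zero ((mul_eq_zero.mp him).resolve_left h2)
  have hfz : (f : ℤ) ≠ 0 := mod_cast hf
  obtain rfl := (mul_eq_zero.mp hc).resolve_right hfz
  obtain rfl := (mul_eq_zero.mp hd).resolve_right hfz
  refine ⟨?_, ?_, rfl, rfl⟩ <;> linarith

/-- The ring map `ℤ[x,y] → ℂ`, `x ↦ √−2`, `y ↦ f·w`, is surjective onto `R_f`
with kernel the ideal generated by `x² + 2` and `y² − f·x·y − f²(D+1)/2`; hence
it induces an isomorphism `ℤ[x,y]/(x² + 2, y² − f·x·y − f²(D+1)/2) ≅ R_f`. -/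
theorem Rf_presentation (D : ℕ) (hD0 : 0 < D) (hDsf : Squarefree D) (hD4 : D % 4 = 1)
    (f : ℕ) (hf1 : Odd f) (hf0 : 0 < f) (m : ℤ) (hm : 2 * m = (D : ℤ) + 1) :
    (evalRf D f).range = Rf D f ∧
      RingHom.ker (evalRf D f) =
        Ideal.span {(X 0 ^ 2 + 2 : MvPolynomial (Fin 2) ℤ),
          X 1 ^ 2 - C (f : ℤ) * X 0 * X 1 - C ((f : ℤ) ^ 2 * m)} := by
  have hX0 : evalRf D f (X 0) = sm2 := by simp [evalRf]
  have hX1 : evalRf D f (X 1) = f * w D := by simp [evalRf]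
  have hC (a : ℤ) : evalRf D f (C a) = a := by simp [evalRf]
  constructor
  · apply le_antisymm
    · rintro _ ⟨p, rfl⟩
      induction p using MvPolynomial.induction_on with
      | C a => rw [hC]; exact intCast_mem _ a
      | add p q hp hq => rw [map_add]; exact add_mem hp hq
      | mul_X p i hp =>
        rw [map_mul]
        refine mul_mem hp (Subring.subset_closure ?_)
        fin_cases i
        · exact Or.inl hX0
        · exact Or.inr hX1
    · rw [Rf, Subring.closure_le]
      rintro _ (rfl | rfl)
      · exact ⟨X 0, hX0⟩
      · exact ⟨X 1, hX1⟩
  · have hg₁ : evalRf D f (X 0 ^ 2 + 2) = 0 := by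
      rw [map_add, map_pow, hX0, sm2_sq, map_ofNat]
      ring
    have hg₂ : evalRf D f (X 1 ^ 2 - C (f : ℤ) * X 0 * X 1 - C ((f : ℤ) ^ 2 * m)) = 0 := by
      rw [map_sub, map_sub, map_mul, map_mul, map_pow, hX0, hX1, hC, hC]
      push_cast
      linear_combination mul_w_sq hm f
    apply le_antisymm
    · intro p hp
      rw [RingHom.mem_ker] at hp
      obtain ⟨a, b, c, d, u, v, rfl⟩ := exists_normal_form f (f ^ 2 * m) p
      simp only [map_add _ _ (u * _ + v * _), map_add _ (u * _) (v * _), map_mul _ u, map_mul _ v,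
        hg₁, hg₂, mul_zero, add_zero] at hp
      simp only [map_add, map_mul, hX0, hX1, hC] at hp
      obtain ⟨rfl, rfl, rfl, rfl⟩ :=
        coeffs_eq_zero (Nat.odd_iff.mpr (by omega)) hf0.ne' hp
      exact Ideal.mem_span_pair.mpr ⟨u, v, by simp⟩
    · rw [Ideal.span_le]
      rintro _ (rfl | rfl)
      · exact hg₁
      · exact hg₂
end
end

section
/- For every odd positive integer f: #(R₁/fR₁)ˣ · (#(ℤ/fℤ)ˣ)² = #(𝒪/f𝒪)ˣ · #(R⁺₁/fR⁺₁)ˣ · #(S₁/fS₁)ˣ. -/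
noncomputable section
open Complex Pointwise

/-- The ideal `f·R` of a subring `R` of `ℂ`. -/
def fIdeal (R : Subring ℂ) (f : ℕ) : Ideal R := Ideal.span {(f : R)}

open QuadraticAlgebra in
/-- The ring homomorphism `x + y ω ↦ g x + g y * u` out of a quadratic algebra. -/
def quadEval {R S : Type*} [CommRing R] [CommRing S] {a b : R} (g : R →+* S) (u : S)
    (h : u * u = g a + g b * u) : QuadraticAlgebra R a b →+* S where
  toFun z := g z.re + g z.im * u
  map_one' := by simp
  map_zero' := by simp
  map_add' x y := by simp; ring
  map_mul' x y := by
    simp only [re_mul, im_mul, map_add, map_mul]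
    linear_combination (-(g x.im) * g y.im) * h

open QuadraticAlgebra in
/-- Base change of a quadratic algebra along a ring homomorphism. -/
def quadMap {R S : Type*} [CommRing R] [CommRing S] {a b : R} {a' b' : S} (g : R →+* S)
    (ha : g a = a') (hb : g b = b') : QuadraticAlgebra R a b →+* QuadraticAlgebra S a' b' where
  toFun z := ⟨g z.re, g z.im⟩
  map_one' := by ext <;> simp
  map_zero' := by ext <;> simp
  map_add' x y := by ext <;> simp
  map_mul' x y := by subst ha hb; ext <;> simp

lemma quadMap_surjective {R S : Type*} [CommRing R] [CommRing S] {a b : R} {a' b' : S}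
    (g : R →+* S) (ha : g a = a') (hb : g b = b') (hg : Function.Surjective g) :
    Function.Surjective (quadMap g ha hb) := by
  rintro ⟨x, y⟩
  obtain ⟨x, rfl⟩ := hg x
  obtain ⟨y, rfl⟩ := hg y
  exact ⟨⟨x, y⟩, rfl⟩

lemma ker_quadMap {R S : Type*} [CommRing R] [CommRing S] {a b : R} {a' b' : S}
    (g : R →+* S) (ha : g a = a') (hb : g b = b') (f : ℕ)
    (hg : RingHom.ker g = Ideal.span {(f : R)}) :
    RingHom.ker (quadMap g ha hb) = Ideal.span {(f : QuadraticAlgebra R a b)} := by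
  ext z
  have key (x : R) : g x = 0 ↔ (f : R) ∣ x := by
    rw [← RingHom.mem_ker, hg, Ideal.mem_span_singleton]
  have hf : (f : QuadraticAlgebra R a b) = algebraMap R _ (f : R) := by simp
  rw [Ideal.mem_span_singleton, RingHom.mem_ker, hf, QuadraticAlgebra.algebraMap_dvd_iff,
    ← key, ← key]
  exact QuadraticAlgebra.ext_iff

/-- A ring isomorphism induces an isomorphism of quadratic algebras. -/
def quadCongr {R S : Type*} [CommRing R] [CommRing S] {a b : R} {a' b' : S} (e : R ≃+* S)
    (ha : e a = a') (hb : e b = b') : QuadraticAlgebra R a b ≃+* QuadraticAlgebra S a' b' :=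
  RingEquiv.ofBijective (quadMap (e : R →+* S) ha hb) ⟨by
    rw [injective_iff_map_eq_zero]
    intro z hz
    have h := QuadraticAlgebra.ext_iff.1 hz
    exact QuadraticAlgebra.ext (e.map_eq_zero_iff.1 h.1) (e.map_eq_zero_iff.1 h.2),
    quadMap_surjective _ ha hb e.surjective⟩

/-- Completing the square, in a ring in which `2` is invertible with inverse `h`. -/
def quadCompleteSquare {R : Type*} [CommRing R] {a b : R} (h c : R) (h2 : 2 * h = 1)
    (hc : c = a + (h * b) ^ 2) : QuadraticAlgebra R a b ≃+* QuadraticAlgebra R c 0 where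
  toFun z := ⟨z.re + h * b * z.im, z.im⟩
  invFun z := ⟨z.re - h * b * z.im, z.im⟩
  left_inv z := by ext <;> simp
  right_inv z := by ext <;> simp
  map_add' x y := by ext <;> simp; ring
  map_mul' x y := by
    subst hc
    ext
    · simp; linear_combination (-h * b ^ 2 * x.im * y.im) * h2
    · simp; linear_combination (-b * x.im * y.im) * h2

/-- Rescaling the generator of a quadratic algebra by a unit. -/
def quadScale {R : Type*} [CommRing R] {a c : R} (u : Rˣ) (h : a = u ^ 2 * c) :
    QuadraticAlgebra R a 0 ≃+* QuadraticAlgebra R c 0 where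
  toFun z := ⟨z.re, u * z.im⟩
  invFun z := ⟨z.re, (u⁻¹ : Rˣ) * z.im⟩
  left_inv z := by ext <;> simp
  right_inv z := by ext <;> simp
  map_add' x y := by ext <;> simp; ring
  map_mul' x y := by
    subst h
    ext <;> simp <;> ring

/-- A quadratic algebra obtained by adjoining a root of the square of a unit splits. -/
def quadSplit {R : Type*} [CommRing R] {a : R} (h : R) (h2 : 2 * h = 1) (u : Rˣ)
    (ha : a = u ^ 2) : QuadraticAlgebra R a 0 ≃+* R × R where
  toFun z := (z.re + u * z.im, z.re - u * z.im)
  invFun p := ⟨h * (p.1 + p.2), (u⁻¹ : Rˣ) * (h * (p.1 - p.2))⟩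
  left_inv z := by
    ext
    · simp; linear_combination z.re * h2
    · simp; linear_combination z.im * h2 + 2 * h * z.im * u.inv_mul
  right_inv p := by
    ext
    · simp; linear_combination p.1 * h2
    · simp; linear_combination p.2 * h2
  map_add' x y := by ext <;> simp <;> ring
  map_mul' x y := by
    subst ha
    ext <;> simp <;> ring

/-- The two ways of writing a biquadratic algebra as a tower agree. -/
def quadSwap {R : Type*} [CommRing R] (a d : R) :
    QuadraticAlgebra (QuadraticAlgebra R a 0) (algebraMap _ _ d) 0 ≃+*
      QuadraticAlgebra (QuadraticAlgebra R d 0) (algebraMap _ _ a) 0 where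
  toFun z := ⟨⟨z.re.re, z.im.re⟩, ⟨z.re.im, z.im.im⟩⟩
  invFun z := ⟨⟨z.re.re, z.im.re⟩, ⟨z.re.im, z.im.im⟩⟩
  left_inv z := rfl
  right_inv z := rfl
  map_add' x y := rfl
  map_mul' x y := by
    ext <;> simp <;> ring

/-- A quadratic algebra over a product is the product of the quadratic algebras. -/
def quadProd {R S : Type*} [CommRing R] [CommRing S] (a b : R × S) :
    QuadraticAlgebra (R × S) a b ≃+* QuadraticAlgebra R a.1 b.1 × QuadraticAlgebra S a.2 b.2 where
  toFun z := (⟨z.re.1, z.im.1⟩, ⟨z.re.2, z.im.2⟩)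
  invFun p := ⟨(p.1.re, p.2.re), (p.1.im, p.2.im)⟩
  left_inv z := rfl
  right_inv z := rfl
  map_add' x y := rfl
  map_mul' x y := by
    ext <;> simp

lemma card_units_congr {R S : Type*} [CommRing R] [CommRing S] (e : R ≃+* S) :
    Nat.card Rˣ = Nat.card Sˣ :=
  Nat.card_congr (Units.mapEquiv e.toMulEquiv).toEquiv

lemma card_units_prod (R S : Type*) [CommRing R] [CommRing S] :
    Nat.card (R × S)ˣ = Nat.card Rˣ * Nat.card Sˣ := by
  rw [Nat.card_congr (MulEquiv.prodUnits (M := R) (N := S)).toEquiv, Nat.card_prod]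

lemma card_units_quad_of_isNilpotent {R : Type*} [CommRing R] {a : R} (ha : IsNilpotent a) :
    Nat.card (QuadraticAlgebra R a 0)ˣ = Nat.card R * Nat.card Rˣ := by
  have key (z : QuadraticAlgebra R a 0) : IsUnit z ↔ IsUnit z.re := by
    rw [QuadraticAlgebra.isUnit_iff_norm_isUnit, QuadraticAlgebra.norm_def]
    have hn : IsNilpotent (-(a * z.im * z.im)) :=
      ((Commute.all _ _).isNilpotent_mul_right ((Commute.all _ _).isNilpotent_mul_right ha)).neg
    have : z.re * z.re + 0 * z.re * z.im - a * z.im * z.im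
        = z.re * z.re + -(a * z.im * z.im) := by ring
    rw [this]
    refine ⟨fun h => ?_, fun h => hn.isUnit_add_left_of_commute (h.mul h) (Commute.all _ _)⟩
    have := hn.neg.isUnit_add_left_of_commute h (Commute.all _ _)
    rw [add_neg_cancel_right] at this
    exact isUnit_of_mul_isUnit_left this
  rw [mul_comm, ← Nat.card_prod]
  refine Nat.card_congr
    { toFun z := (((key z).1 z.isUnit).unit, (z : QuadraticAlgebra R a 0).im)
      invFun p := ((key ⟨p.1, p.2⟩).2 p.1.isUnit).unit
      left_inv z := by ext <;> rfl
      right_inv p := by ext <;> rfl }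

/-- The relation between the numbers of units of a biquadratic algebra over `R` and of its three
quadratic subalgebras. -/
def UnitsRelation (R : Type*) [CommRing R] (a d : R) : Prop :=
  Nat.card (QuadraticAlgebra (QuadraticAlgebra R a 0) (algebraMap _ _ d) 0)ˣ * Nat.card Rˣ ^ 2 =
    Nat.card (QuadraticAlgebra R a 0)ˣ * Nat.card (QuadraticAlgebra R d 0)ˣ *
      Nat.card (QuadraticAlgebra R (a * d) 0)ˣ

lemma UnitsRelation.of_isNilpotent {R : Type*} [CommRing R] {a d : R} (hd : IsNilpotent d) :
    UnitsRelation R a d := by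
  rw [UnitsRelation, card_units_quad_of_isNilpotent hd,
    card_units_quad_of_isNilpotent ((Commute.all a d).isNilpotent_mul_left hd),
    card_units_quad_of_isNilpotent (hd.map (algebraMap R (QuadraticAlgebra R a 0))),
    Nat.card_congr (QuadraticAlgebra.equivProd a (0 : R)), Nat.card_prod]
  ring

lemma UnitsRelation.symm {R : Type*} [CommRing R] {a d : R} (h : UnitsRelation R a d) :
    UnitsRelation R d a := by
  rw [UnitsRelation] at *
  rw [← card_units_congr (quadSwap a d), h, mul_comm d a]
  ring

lemma UnitsRelation.of_sq_right {R : Type*} [CommRing R] {h a : R} (h2 : 2 * h = 1) (u : Rˣ) :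
    UnitsRelation R a (u ^ 2 : R) := by
  have hs : algebraMap R (QuadraticAlgebra R a 0) ((u : R) ^ 2) =
      ((Units.map (algebraMap R (QuadraticAlgebra R a 0)).toMonoidHom u : _ˣ) :
        QuadraticAlgebra R a 0) ^ 2 := by simp
  have h2' : 2 * algebraMap R (QuadraticAlgebra R a 0) h = 1 := by
    rw [← map_ofNat (algebraMap R (QuadraticAlgebra R a 0)) 2, ← map_mul, h2, map_one]
  rw [UnitsRelation, card_units_congr (quadSplit _ h2' _ hs),
    card_units_congr (quadSplit h h2 u rfl), card_units_prod, card_units_prod,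
    card_units_congr (quadScale u (mul_comm a ((u : R) ^ 2)))]
  ring

lemma UnitsRelation.of_mul_eq_sq {R : Type*} [CommRing R] {h : R} (h2 : 2 * h = 1) (a d u : Rˣ)
    (had : a * d = u ^ 2) : UnitsRelation R (a : R) d := by
  have hω : (QuadraticAlgebra.omega : QuadraticAlgebra R (a : R) 0) *
      (algebraMap R _ (a⁻¹ : Rˣ) * QuadraticAlgebra.omega) = 1 := by
    ext <;> simp [QuadraticAlgebra.re_one, QuadraticAlgebra.im_one]
  let v : (QuadraticAlgebra R (a : R) 0)ˣ := ⟨_, _, hω, by rw [mul_comm, hω]⟩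
  let A : Rˣ →* (QuadraticAlgebra R (a : R) 0)ˣ := Units.map (algebraMap R _).toMonoidHom
  have hv : v ^ 2 = A a := by
    ext <;> simp [v, A, pow_two]
  have hd : d = u ^ 2 * a⁻¹ := by rw [← had]; simp
  have hs : algebraMap R (QuadraticAlgebra R (a : R) 0) (d : R) =
      ((A u * A a⁻¹ * v : _ˣ) : QuadraticAlgebra R (a : R) 0) ^ 2 := by
    rw [← Units.val_pow_eq_pow_val]
    change ((A d : _ˣ) : QuadraticAlgebra R (a : R) 0) = _
    rw [mul_pow, hv, hd, mul_pow, map_mul, map_pow, map_inv]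
    congr 1
    group
  have h2' : 2 * algebraMap R (QuadraticAlgebra R (a : R) 0) h = 1 := by
    rw [← map_ofNat (algebraMap R (QuadraticAlgebra R (a : R) 0)) 2, ← map_mul, h2, map_one]
  have had' : (a : R) * d = (u : R) ^ 2 := by exact_mod_cast congrArg Units.val had
  have hd' : (d : R) = ((u * a⁻¹ : Rˣ) : R) ^ 2 * a := by
    rw [← Units.val_pow_eq_pow_val, ← Units.val_mul, hd, mul_pow]
    congr 1
    group
  rw [UnitsRelation, card_units_congr (quadSplit _ h2' _ hs),
    card_units_congr (quadSplit h h2 u had'), card_units_prod, card_units_prod,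
    card_units_congr (quadScale _ hd')]
  ring

lemma UnitsRelation.congr {R S : Type*} [CommRing R] [CommRing S] (e : R ≃+* S) {a d : R}
    (h : UnitsRelation S (e a) (e d)) : UnitsRelation R a d := by
  let e' : QuadraticAlgebra R a 0 ≃+* QuadraticAlgebra S (e a) 0 := quadCongr e rfl (map_zero e)
  have he' : e' (algebraMap _ _ d) = algebraMap _ _ (e d) := by
    ext
    · rfl
    · exact map_zero e
  rw [UnitsRelation] at *
  rw [card_units_congr (quadCongr e' he' (map_zero e')),
    card_units_congr (quadCongr e (map_mul e a d) (map_zero e)), card_units_congr e',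
    card_units_congr (quadCongr e (a := d) rfl (map_zero e)), card_units_congr e, h]

lemma UnitsRelation.prod {R S : Type*} [CommRing R] [CommRing S] {a d : R × S}
    (h₁ : UnitsRelation R a.1 d.1) (h₂ : UnitsRelation S a.2 d.2) :
    UnitsRelation (R × S) a d := by
  have he : quadProd a 0 (algebraMap _ _ d) = (algebraMap _ _ d.1, algebraMap _ _ d.2) := rfl
  rw [UnitsRelation] at *
  rw [card_units_congr (quadCongr (quadProd a 0) he (map_zero _)),
    card_units_congr (quadProd _ _), card_units_congr (quadProd a 0),
    card_units_congr (quadProd d 0), card_units_congr (quadProd (a * d) 0),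
    card_units_prod, card_units_prod, card_units_prod, card_units_prod, card_units_prod]
  simp only [Prod.fst_zero, Prod.snd_zero, Prod.fst_mul, Prod.snd_mul] at *
  linear_combination (Nat.card (QuadraticAlgebra
    (QuadraticAlgebra S a.2 0) (algebraMap _ _ d.2) 0)ˣ * Nat.card Sˣ ^ 2) * h₁ +
    (Nat.card (QuadraticAlgebra R a.1 0)ˣ * Nat.card (QuadraticAlgebra R d.1 0)ˣ *
      Nat.card (QuadraticAlgebra R (a.1 * d.1) 0)ˣ) * h₂

lemma isSquare_or_isSquare_or_isSquare_mul {G : Type*} [CommGroup G] [IsCyclic G] (a d : G) :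
    IsSquare a ∨ IsSquare d ∨ IsSquare (a * d) := by
  obtain ⟨g, hg⟩ := IsCyclic.exists_generator (α := G)
  obtain ⟨m, rfl⟩ := Subgroup.mem_zpowers_iff.1 (hg a)
  obtain ⟨n, rfl⟩ := Subgroup.mem_zpowers_iff.1 (hg d)
  rcases Int.even_or_odd m with hm | hm
  · exact .inl (hm.isSquare_zpow g)
  rcases Int.even_or_odd n with hn | hn
  · exact .inr (.inl (hn.isSquare_zpow g))
  · exact .inr (.inr (zpow_add g m n ▸ (hm.add_odd hn).isSquare_zpow g))

lemma ZMod.isUnit_or_isNilpotent_of_prime_pow {p : ℕ} (hp : p.Prime) (n : ℕ) (x : ZMod (p ^ n)) :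
    IsUnit x ∨ IsNilpotent x := by
  obtain ⟨k, rfl⟩ := ZMod.intCast_surjective x
  by_cases hk : (p : ℤ) ∣ k
  · right
    obtain ⟨c, rfl⟩ := hk
    refine ⟨n, ?_⟩
    push_cast
    rw [mul_pow, ← Nat.cast_pow, ZMod.natCast_self, zero_mul]
  · left
    have : IsCoprime k ((p ^ n : ℕ) : ℤ) := by
      push_cast
      exact ((Nat.prime_iff_prime_int.1 hp).coprime_iff_not_dvd.2 hk).symm.pow_right
    obtain ⟨s, t, hst⟩ := this
    refine IsUnit.of_mul_eq_one (s : ZMod (p ^ n)) ?_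
    have := congrArg (Int.cast (R := ZMod (p ^ n))) hst
    simp only [Int.cast_add, Int.cast_mul, Int.cast_natCast, ZMod.natCast_self, mul_zero, add_zero,
      Int.cast_one] at this
    rw [mul_comm, this]

lemma ZMod.two_mul_half {f : ℕ} (hf : Odd f) : (2 : ZMod f) * ((f + 1) / 2 : ℕ) = 1 := by
  have h : 2 * ((f + 1) / 2) = f + 1 := by obtain ⟨k, rfl⟩ := hf; omega
  have := congrArg (Nat.cast (R := ZMod f)) h
  simpa using this

theorem unitsRelation_zmod {f : ℕ} (hf : Odd f) (a d : ZMod f) : UnitsRelation (ZMod f) a d := by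
  induction f using Nat.recOnPosPrimePosCoprime with
  | zero => simp at hf
  | one => simp [UnitsRelation]
  | prime_pow p n hp hn =>
    have h2 := ZMod.two_mul_half hf
    rcases ZMod.isUnit_or_isNilpotent_of_prime_pow hp n a with ⟨a, rfl⟩ | ha
    swap
    · exact (UnitsRelation.of_isNilpotent ha).symm
    rcases ZMod.isUnit_or_isNilpotent_of_prime_pow hp n d with ⟨d, rfl⟩ | hd
    swap
    · exact .of_isNilpotent hd
    have hp2 : p ≠ 2 := by
      rintro rfl
      exact (Nat.not_even_iff_odd.2 hf) ((Nat.even_pow' hn.ne').2 even_two)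
    have := ZMod.isCyclic_units_of_prime_pow p hp hp2 n
    rcases isSquare_or_isSquare_or_isSquare_mul a d with h | h | h
    · obtain ⟨u, rfl⟩ := h
      simpa [pow_two] using (UnitsRelation.of_sq_right (a := (d : ZMod (p ^ n))) h2 u).symm
    · obtain ⟨u, rfl⟩ := h
      simpa [pow_two] using UnitsRelation.of_sq_right (a := (a : ZMod (p ^ n))) h2 u
    · obtain ⟨u, hu⟩ := h
      exact .of_mul_eq_sq h2 a d u (by rw [hu, pow_two])
  | coprime m n _ _ hmn ihm ihn =>
    obtain ⟨hm, hn⟩ := Nat.odd_mul.1 hf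
    exact .congr (ZMod.chineseRemainder hmn) (.prod (ihm hm _ _) (ihn hn _ _))

/-- If `M → N` is surjective with kernel `f M`, then `R / f R ≃ N` for every `R` isomorphic
to `M`. -/
lemma nonempty_quotient_fIdeal_equiv {M N : Type*} [CommRing M] [CommRing N] {R : Subring ℂ}
    {f : ℕ} (e : M ≃+* R) (g : M →+* N) (hg : Function.Surjective g)
    (hk : RingHom.ker g = Ideal.span {(f : M)}) : Nonempty ((R ⧸ fIdeal R f) ≃+* N) := by
  have h1 : fIdeal R f = (Ideal.span {(f : M)}).map (e : M →+* R) := by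
    rw [Ideal.map_span, fIdeal]; simp
  exact ⟨(Ideal.quotientEquiv _ _ e h1).symm.trans
    ((Ideal.quotEquivOfEq hk.symm).trans (RingHom.quotientKerEquivOfSurjective hg))⟩

/-- An injective ring homomorphism is an isomorphism onto its range. -/
lemma nonempty_equiv_of_range_eq {M : Type*} [CommRing M] {g : M →+* ℂ} {R : Subring ℂ}
    (hg : Function.Injective g) (hr : g.range = R) : Nonempty (M ≃+* R) :=
  ⟨(RingEquiv.ofBijective g.rangeRestrict
    ⟨fun _ _ h => hg (congrArg Subtype.val h), g.rangeRestrict_surjective⟩).trans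
      (RingEquiv.subringCongr hr)⟩

lemma quadEval_range_eq_closure {R : Type*} [CommRing R] {a b : R} {g : R →+* ℂ} {u : ℂ}
    (h : u * u = g a + g b * u) {S T : Set ℂ} (hT : g.range = Subring.closure T)
    (hS : S = insert u T) : (quadEval g u h).range = Subring.closure S := by
  have hg (r : R) : g r ∈ Subring.closure S :=
    Subring.closure_mono (hS ▸ Set.subset_insert u T) (hT ▸ ⟨r, rfl⟩)
  apply le_antisymm
  · rintro _ ⟨z, rfl⟩
    exact add_mem (hg _) (mul_mem (hg _) (Subring.subset_closure (hS ▸ Set.mem_insert u T)))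
  · rw [Subring.closure_le, hS]
    rintro x (rfl | hx)
    · exact ⟨⟨0, 1⟩, by simp [quadEval]⟩
    · have : x ∈ g.range := hT ▸ Subring.subset_closure hx
      obtain ⟨r, rfl⟩ := this
      exact ⟨⟨r, 0⟩, by simp [quadEval]⟩

lemma range_intCast_eq_closure_empty : (Int.castRingHom ℂ).range = Subring.closure ∅ := by
  rw [Subring.closure_empty]
  exact le_antisymm (by rintro _ ⟨n, rfl⟩; simp) bot_le

lemma ker_intCast_zmod (f : ℕ) :
    RingHom.ker (Int.castRingHom (ZMod f)) = Ideal.span {(f : ℤ)} :=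
  ZMod.ker_intCastRingHom f

/-- The quotient by `f` of the ring generated by a square root `u` of an integer. -/
lemma nonempty_quotient_closure_equiv {u : ℂ} {a : ℤ} (hu : u * u = a)
    (hinj : ∀ x y : ℤ, (x : ℂ) + y * u = 0 → x = 0 ∧ y = 0) (f : ℕ) :
    Nonempty ((Subring.closure {u} ⧸ fIdeal (Subring.closure {u}) f) ≃+*
      QuadraticAlgebra (ZMod f) (a : ZMod f) 0) := by
  have h : u * u = Int.castRingHom ℂ a + Int.castRingHom ℂ 0 * u := by simp [hu]
  have hi : Function.Injective (quadEval (Int.castRingHom ℂ) u h) := by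
    rw [injective_iff_map_eq_zero]
    intro z hz
    obtain ⟨h1, h2⟩ := hinj z.re z.im hz
    exact QuadraticAlgebra.ext h1 h2
  have hr := quadEval_range_eq_closure h range_intCast_eq_closure_empty
    (S := {u}) (by simp)
  obtain ⟨e⟩ := nonempty_equiv_of_range_eq hi hr
  exact nonempty_quotient_fIdeal_equiv e
    (quadMap (Int.castRingHom (ZMod f)) rfl (map_zero _))
    (quadMap_surjective _ _ _ (ZMod.ringHom_surjective _))
    (ker_quadMap _ _ _ f (ker_intCast_zmod f))

lemma sm2_mul_self : sm2 * sm2 = (-2 : ℤ) := by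
  have h : ((√2 : ℝ) : ℂ) * (√2 : ℝ) = 2 := by
    exact_mod_cast Real.mul_self_sqrt (by norm_num : (0 : ℝ) ≤ 2)
  rw [sm2]
  push_cast
  linear_combination (√2 : ℝ) * (√2 : ℝ) * I_mul_I - h

lemma smD_mul_self (D : ℕ) : smD D * smD D = (-D : ℤ) := by
  have h : ((√D : ℝ) : ℂ) * (√D : ℝ) = D := by
    exact_mod_cast Real.mul_self_sqrt (Nat.cast_nonneg D)
  rw [smD]
  push_cast
  linear_combination (√D : ℝ) * (√D : ℝ) * I_mul_I - h

lemma s2D_mul_self (D : ℕ) : s2D D * s2D D = (2 * D : ℤ) := by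
  have h : ((√(2 * D) : ℝ) : ℂ) * (√(2 * D) : ℝ) = 2 * D := by
    exact_mod_cast Real.mul_self_sqrt (by positivity : (0 : ℝ) ≤ 2 * D)
  rw [s2D, h]
  push_cast
  rfl

lemma w_mul_self (D : ℕ) : w D * w D = ((D + 1 : ℂ) / 2) + sm2 * w D := by
  have h1 := sm2_mul_self
  have h2 := s2D_mul_self D
  rw [w]
  push_cast at *
  linear_combination h2 / 4 - h1 / 4

lemma int_add_mul_I_mul_eq_zero {s : ℝ} (hs : s ≠ 0) {x y : ℤ}
    (h : (x : ℂ) + y * (I * s) = 0) : x = 0 ∧ y = 0 := by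
  have hre := congrArg Complex.re h
  have him := congrArg Complex.im h
  simp [hs] at hre him
  exact ⟨hre, him⟩

lemma irrational_sqrt_two_mul {D : ℕ} (hD : Odd D) : Irrational √(2 * D : ℝ) := by
  have : ((2 * D : ℕ) : ℝ) = 2 * D := by push_cast; rfl
  rw [← this, irrational_sqrt_natCast_iff]
  rintro ⟨r, hr⟩
  have h2 : 2 ∣ r := by
    rcases Nat.prime_two.dvd_mul.1 (hr ▸ dvd_mul_right 2 D) with h | h <;> exact h
  obtain ⟨s, rfl⟩ := h2
  obtain ⟨k, rfl⟩ := hD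
  have : 2 * k + 1 = 2 * (s * s) := by linarith
  omega

lemma int_add_mul_irrational_eq_zero {s : ℝ} (hs : Irrational s) {x y : ℤ}
    (h : (x : ℝ) + y * s = 0) : x = 0 ∧ y = 0 := by
  have hy : y = 0 := by
    by_contra hy
    exact ((hs.intCast_mul hy).intCast_add x).ne_zero h
  subst hy
  simpa using h

lemma nonempty_quotient_OO_equiv (f : ℕ) :
    Nonempty ((OO ⧸ fIdeal OO f) ≃+* QuadraticAlgebra (ZMod f) ((-2 : ℤ) : ZMod f) 0) :=
  nonempty_quotient_closure_equiv sm2_mul_self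
    (fun _ _ h => int_add_mul_I_mul_eq_zero (by positivity) h) f

lemma nonempty_quotient_Sf_equiv {D : ℕ} (hD : 0 < D) (f : ℕ) :
    Nonempty ((Sf D 1 ⧸ fIdeal (Sf D 1) f) ≃+*
      QuadraticAlgebra (ZMod f) ((-D : ℤ) : ZMod f) 0) := by
  have hS : Sf D 1 = Subring.closure {smD D} := by simp [Sf]
  rw [hS]
  exact nonempty_quotient_closure_equiv (smD_mul_self D)
    (fun _ _ h => int_add_mul_I_mul_eq_zero (by positivity) h) f

lemma nonempty_quotient_Rpf_equiv {D : ℕ} (hD : Odd D) (f : ℕ) :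
    Nonempty ((Rpf D 1 ⧸ fIdeal (Rpf D 1) f) ≃+*
      QuadraticAlgebra (ZMod f) ((2 * D : ℤ) : ZMod f) 0) := by
  have hS : Rpf D 1 = Subring.closure {s2D D} := by simp [Rpf]
  rw [hS]
  exact nonempty_quotient_closure_equiv (s2D_mul_self D)
    (fun _ _ h => int_add_mul_irrational_eq_zero (irrational_sqrt_two_mul hD)
      (by rw [s2D] at h; exact_mod_cast h)) f

lemma nonempty_quotient_Rf_equiv {D m : ℕ} (hD : Odd D) (hm : D + 1 = 2 * m) (f : ℕ) :
    Nonempty ((Rf D 1 ⧸ fIdeal (Rf D 1) f) ≃+*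
      QuadraticAlgebra (QuadraticAlgebra (ZMod f) ((-2 : ℤ) : ZMod f) 0) (m : ℕ) ⟨0, 1⟩) := by
  have hS : Rf D 1 = Subring.closure {sm2, w D} := by simp [Rf]
  rw [hS]
  have h : sm2 * sm2 = Int.castRingHom ℂ (-2) + Int.castRingHom ℂ 0 * sm2 := by
    simpa using sm2_mul_self
  let g := quadEval (Int.castRingHom ℂ) sm2 h
  have hm' : (D + 1 : ℂ) = 2 * m := by exact_mod_cast hm
  have hw : w D * w D = g (m : ℕ) + g ⟨0, 1⟩ * w D := by
    have : g ⟨0, 1⟩ = sm2 := by simp [g, quadEval]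
    rw [map_natCast, this, w_mul_self, hm']
    ring
  have hi : Function.Injective (quadEval g (w D) hw) := by
    rw [injective_iff_map_eq_zero]
    rintro ⟨⟨p₁, p₂⟩, ⟨q₁, q₂⟩⟩ hz
    change ((p₁ : ℂ) + p₂ * sm2) + (q₁ + q₂ * sm2) * w D = 0 at hz
    have h2 := sm2_mul_self
    have hz' : ((2 * p₁ - 2 * q₂ : ℤ) : ℂ) + q₁ * s2D D +
        ((2 * p₂ + q₁ : ℤ) + q₂ * s2D D) * sm2 = 0 := by
      rw [w] at hz
      push_cast at h2 ⊢
      linear_combination 2 * hz - q₂ * h2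
    have hre := congrArg Complex.re hz'
    have him := congrArg Complex.im hz'
    simp [sm2, s2D] at hre him
    have hirr := irrational_sqrt_two_mul hD
    obtain ⟨h1, h3⟩ := int_add_mul_irrational_eq_zero hirr
      (x := 2 * p₁ - 2 * q₂) (y := q₁) (by simpa using hre)
    obtain ⟨h4, h5⟩ := int_add_mul_irrational_eq_zero hirr
      (x := 2 * p₂ + q₁) (y := q₂) (by simpa using him)
    ext <;> simp <;> omega
  have hr := quadEval_range_eq_closure hw
    (quadEval_range_eq_closure h range_intCast_eq_closure_empty (S := {sm2}) (by simp))
    (S := {sm2, w D}) (Set.pair_comm _ _)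
  obtain ⟨e⟩ := nonempty_equiv_of_range_eq hi hr
  let k : QuadraticAlgebra ℤ (-2) 0 →+* QuadraticAlgebra (ZMod f) ((-2 : ℤ) : ZMod f) 0 :=
    quadMap (Int.castRingHom (ZMod f)) rfl (map_zero _)
  have hk : k ⟨0, 1⟩ = ⟨0, 1⟩ := by ext <;> simp [k, quadMap]
  exact nonempty_quotient_fIdeal_equiv e (quadMap k (map_natCast k m) hk)
    (quadMap_surjective _ _ _ (quadMap_surjective _ _ _ (ZMod.ringHom_surjective _)))
    (ker_quadMap _ _ _ f (ker_quadMap _ _ _ f (ker_intCast_zmod f)))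

/-- For every odd positive integer `f`:
`#(R₁/fR₁)ˣ · (#(ℤ/fℤ)ˣ)² = #(𝒪/f𝒪)ˣ · #(R⁺₁/fR⁺₁)ˣ · #(S₁/fS₁)ˣ`. -/
theorem units_card_relation (D : ℕ) (hD0 : 0 < D) (hDsf : Squarefree D)
    (hD4 : D % 4 = 1) (f : ℕ) (hf1 : Odd f) (hf0 : 0 < f) :
    Nat.card ((Rf D 1 ⧸ fIdeal (Rf D 1) f)ˣ) * (Nat.card (ZMod f)ˣ) ^ 2 =
      Nat.card ((OO ⧸ fIdeal OO f)ˣ) * Nat.card ((Rpf D 1 ⧸ fIdeal (Rpf D 1) f)ˣ) *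
        Nat.card ((Sf D 1 ⧸ fIdeal (Sf D 1) f)ˣ) := by
  have hDodd : Odd D := Nat.odd_iff.2 (by omega)
  obtain ⟨m, hm⟩ : ∃ m, D + 1 = 2 * m := ⟨(D + 1) / 2, by omega⟩
  obtain ⟨eO⟩ := nonempty_quotient_OO_equiv f
  obtain ⟨eS⟩ := nonempty_quotient_Sf_equiv hD0 f
  obtain ⟨eP⟩ := nonempty_quotient_Rpf_equiv hDodd f
  obtain ⟨eR⟩ := nonempty_quotient_Rf_equiv hDodd hm f
  rw [card_units_congr eO, card_units_congr eS, card_units_congr eP, card_units_congr eR]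
  have h2 := ZMod.two_mul_half hf1
  set h : ZMod f := (((f + 1) / 2 : ℕ) : ZMod f)
  have hm' : (D + 1 : ZMod f) = 2 * m := by exact_mod_cast congrArg (Nat.cast (R := ZMod f)) hm
  have h2' : 2 * algebraMap (ZMod f) (QuadraticAlgebra (ZMod f) ((-2 : ℤ) : ZMod f) 0) h = 1 := by
    rw [← map_ofNat (algebraMap (ZMod f) (QuadraticAlgebra (ZMod f) ((-2 : ℤ) : ZMod f) 0)) 2,
      ← map_mul, h2, map_one]
  let u : (ZMod f)ˣ := ⟨2, h, h2, by rw [mul_comm, h2]⟩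
  have hd : algebraMap (ZMod f) (QuadraticAlgebra (ZMod f) ((-2 : ℤ) : ZMod f) 0) (D * h) =
      (m : ℕ) + (algebraMap _ _ h * ⟨0, 1⟩) ^ 2 := by
    ext
    · simp [pow_two]
      linear_combination h * hm' + (m + h) * h2
    · simp [pow_two]
  have hP : ((2 * D : ℤ) : ZMod f) = (u : ZMod f) ^ 2 * (D * h) := by
    simp only [u]
    push_cast
    linear_combination (-2 * D : ZMod f) * h2
  have hS : ((-D : ℤ) : ZMod f) = ((-2 : ℤ) : ZMod f) * (D * h) := by
    push_cast
    linear_combination (D : ZMod f) * h2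
  rw [card_units_congr (quadCompleteSquare _ _ h2' hd), card_units_congr (quadScale u hP), hS]
  exact unitsRelation_zmod hf1 _ _
end
end
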